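/- Let $(V,F)$ be a real normed vector space of finite dimension $n\ge 1$ and let $y\in V$, $y\neq 0$. Say that $x$ is normal to $w$ (written $x\dashv w$) if $F(x+\alpha w)\ge F(x)$ for all $\alpha\in\mathbb R$, and put $W_y=\{w\in V : y\dashv w\}$. (1) If $F$ is differentiable at $y$ (in particular, if the unit sphere of $F$ is $C^1$), then $W_y$ is a linear hyperplane of $V$. (2) For an arbitrary norm $F$, let $b_2,\dots,b_n$ be linearly independent vectors such that $y\dashv w$ for every $w\in\operatorname{span}(b_2,\dots,b_n)$; if $F$ is differentiable at $y$, this means that $b_2,\dots,b_n$ is a basis of $W_y$. Then $b_1=y,b_2,\dots,b_n$ is a basis of $V$. Set $$B^n=\Big\{(y^1,\dots,y^n)\in\mathbb R^n : F\Big(\sum_{i=1}^n y^ib_i\Big)<1\Big\},\qquad B^{n-1}_y=\Big\{(y^2,\dots,y^n)\in\mathbb R^{n-1} : F\Big(\sum_{j=2}^n y^jb_j\Big)<1\Big\},$$ and let $\mathrm{vol}_n$, $\mathrm{vol}_{n-1}$ be the Lebesgue measures on $\mathbb R^n$, $\mathbb R^{n-1}$ (for $n=1$, $\mathbb R^0$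 is a point of measure $1$). If $F(y)=1$, then $$\mathrm{vol}_{n-1}(B^{n-1}_y)\le 2^n\,\mathrm{vol}_n(B^n)\qquad\text{and}\qquad \mathrm{vol}_n(B^n)\le 2^n\,\mathrm{vol}_{n-1}(B^{n-1}_y).$$ Moreover, for every $y\ne 0$, with $c_n=\mathrm{vol}_n(\mathbb B^n)/\mathrm{vol}_{n-1}(\mathbb B^{n-1})$, where $\mathbb B^k$ is the Euclidean unit ball of $\mathbb R^k$, and $$\zeta(y)=c_n\cdot\frac{\mathrm{vol}_{n-1}(B^{n-1}_y)}{F(y)\,\mathrm{vol}_n(B^n)},$$ one has $2^{-n}c_n\le\zeta(y)\le 2^nc_n$. -/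

import Mathlib

open MeasureTheory

noncomputable section

/-- `x` is normal to `w` (written `x ⊣ w`) in the normed space `(V, F)`:
`F(x + α • w) ≥ F(x)` for every `α : ℝ`. -/
def IsNormalTo {V : Type*} [NormedAddCommGroup V] [NormedSpace ℝ V] (x w : V) : Prop :=
  ∀ α : ℝ, ‖x‖ ≤ ‖x + α • w‖

/-- The set `W_y = {w ∈ V | y ⊣ w}`. -/
def normalSet {V : Type*} [NormedAddCommGroup V] [NormedSpace ℝ V] (y : V) : Set V :=
  {w | IsNormalTo y w}

/-- The open unit ball of `F` read in the coordinates given by a family `b` of `k` vectors: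
`{(c¹, …, cᵏ) ∈ ℝᵏ | F(∑ᵢ cⁱ bᵢ) < 1}`. -/
def coordBall {V : Type*} [NormedAddCommGroup V] [NormedSpace ℝ V] {k : ℕ} (b : Fin k → V) :
    Set (Fin k → ℝ) :=
  {c | ‖∑ i, c i • b i‖ < 1}

/-- The volume of the Euclidean unit ball of `ℝᵏ`. -/
def euclBallVol (k : ℕ) : ℝ :=
  volume.real (Metric.ball (0 : EuclideanSpace ℝ (Fin k)) 1)

/-- `c_n = vol(𝔹ⁿ) / vol(𝔹ⁿ⁻¹)` for `n = m + 1`. -/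
def ballRatio (m : ℕ) : ℝ :=
  euclBallVol (m + 1) / euclBallVol m

/-- `ζ(y) = c_n · vol(B_y^{n-1}(b₂, …, bₙ)) / (F(y) · vol(Bⁿ(y, b₂, …, bₙ)))` for `n = m + 1`,
computed with the vectors `b₂, …, bₙ` (here `b : Fin m → V`). -/
def zeta {V : Type*} [NormedAddCommGroup V] [NormedSpace ℝ V] {m : ℕ} (y : V) (b : Fin m → V) :
    ℝ :=
  ballRatio m * (volume.real (coordBall b) /
    (‖y‖ * volume.real (coordBall (Fin.cons y b : Fin (m + 1) → V))))

end

section NormalVectors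

variable {V : Type*} [NormedAddCommGroup V] [NormedSpace ℝ V]

/-- Where the norm is differentiable, the vectors to which `y` is normal form the kernel of its
derivative. -/
theorem normalSet_eq_ker_fderiv_norm {y : V} (h : DifferentiableAt ℝ (fun v : V => ‖v‖) y) :
    normalSet y = (LinearMap.ker (fderiv ℝ (fun v : V => ‖v‖) y).toLinearMap : Set V) := by
  ext w
  simp only [normalSet, IsNormalTo, Set.mem_ofPred_eq, SetLike.mem_coe, LinearMap.mem_ker,
    ContinuousLinearMap.coe_coe]
  constructor
  · intro hw
    have hd := h.hasFDerivAt.hasLineDerivAt w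
    have hmin : IsLocalMin (fun t : ℝ => ‖y + t • w‖) 0 :=
      Filter.Eventually.of_forall fun t => by simpa using hw t
    exact hmin.hasDerivAt_eq_zero hd
  · intro hw α
    have hL : ‖fderiv ℝ (fun v : V => ‖v‖) y‖ ≤ 1 := by
      simpa using norm_fderiv_le_of_lipschitz ℝ (f := fun v : V => ‖v‖) (x₀ := y)
        lipschitzWith_one_norm
    calc ‖y‖ = fderiv ℝ (fun v : V => ‖v‖) y (y + α • w) := by
          rw [map_add, map_smul, hw, smul_zero, add_zero, h.fderiv_norm_self]
      _ ≤ ‖fderiv ℝ (fun v : V => ‖v‖) y (y + α • w)‖ := Real.le_norm_self _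
      _ ≤ 1 * ‖y + α • w‖ := ContinuousLinearMap.le_of_opNorm_le _ hL _
      _ = ‖y + α • w‖ := one_mul _

theorem finrank_ker_fderiv_norm_add_one [FiniteDimensional ℝ V] {y : V} (hy : y ≠ 0)
    (h : DifferentiableAt ℝ (fun v : V => ‖v‖) y) :
    Module.finrank ℝ (LinearMap.ker (fderiv ℝ (fun v : V => ‖v‖) y).toLinearMap) + 1 =
      Module.finrank ℝ V := by
  refine Module.Dual.finrank_ker_add_one_of_ne_zero fun h0 => hy ?_
  have := h.fderiv_norm_self
  rw [← norm_eq_zero, ← this]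
  exact LinearMap.congr_fun h0 y

theorem not_isNormalTo_self {y : V} (hy : y ≠ 0) : ¬ IsNormalTo y y := fun h => by
  have := h (-1)
  simp [hy] at this

/-- Normality to every vector of a subspace bounds the coefficient along `y`. -/
theorem abs_mul_norm_le_norm_smul_add {y w : V} {W : Submodule ℝ V}
    (hW : (W : Set V) ⊆ normalSet y) (hw : w ∈ W) (t : ℝ) : |t| * ‖y‖ ≤ ‖t • y + w‖ := by
  rcases eq_or_ne t 0 with rfl | ht
  · simp
  calc |t| * ‖y‖ ≤ |t| * ‖y + t⁻¹ • w‖ := by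
        gcongr
        exact hW hw t⁻¹
    _ = ‖t • y + w‖ := by
        rw [← Real.norm_eq_abs, ← norm_smul, smul_add, smul_inv_smul₀ ht]

end NormalVectors

section CoordBall

variable {V : Type*} [NormedAddCommGroup V] [NormedSpace ℝ V] {k m : ℕ}

theorem isOpen_coordBall (b : Fin k → V) : IsOpen (coordBall b) :=
  isOpen_lt (by fun_prop) continuous_const

theorem zero_mem_coordBall (b : Fin k → V) : (0 : Fin k → ℝ) ∈ coordBall b := by
  simp [coordBall]

theorem volume_coordBall_pos (b : Fin k → V) : 0 < volume (coordBall b) :=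
  (isOpen_coordBall b).measure_pos volume ⟨0, zero_mem_coordBall b⟩

theorem isBounded_coordBall {b : Fin k → V} (hb : LinearIndependent ℝ b) :
    Bornology.IsBounded (coordBall b) := by
  obtain ⟨K, -, hK⟩ := (Fintype.linearCombination ℝ b).exists_antilipschitzWith
    (LinearMap.ker_eq_bot.2 hb.fintypeLinearCombination_injective)
  refine (hK.isBounded_preimage (Metric.isBounded_ball (x := (0 : V)) (r := 1))).subset ?_
  intro c hc
  simpa [coordBall, Fintype.linearCombination_apply] using hc

theorem volume_coordBall_lt_top {b : Fin k → V} (hb : LinearIndependent ℝ b) :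
    volume (coordBall b) < ⊤ :=
  (isBounded_coordBall hb).measure_lt_top

/-- The cylinder over a dilate of the coordinate ball of `b`. -/
def coordCylinder (b : Fin m → V) (a s : ℝ) : Set (Fin (m + 1) → ℝ) :=
  {c | |c 0| < a ∧ s • Fin.tail c ∈ coordBall b}

theorem volume_coordCylinder (b : Fin m → V) (a : ℝ) {s : ℝ} (hs : 0 < s) :
    volume (coordCylinder b a s) =
      ENNReal.ofReal (2 * a) * (ENNReal.ofReal (s ^ m)⁻¹ * volume (coordBall b)) := by
  have hpre : coordCylinder b a s = MeasurableEquiv.piFinSuccAbove (fun _ => ℝ) 0 ⁻¹'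
      (Metric.ball (0 : ℝ) a ×ˢ ((s • ·) ⁻¹' coordBall b)) := by
    ext c
    simp [coordCylinder, MeasurableEquiv.piFinSuccAbove, Fin.insertNthEquiv, Fin.removeNth_zero]
  rw [hpre, (volume_preserving_piFinSuccAbove (fun _ => ℝ) 0).measure_preimage_equiv,
    Measure.volume_eq_prod, Measure.prod_prod, Real.volume_ball,
    Measure.addHaar_preimage_smul volume hs.ne', Module.finrank_fin_fun,
    abs_of_pos (by positivity)]

theorem mem_coordBall_cons {y : V} {b : Fin m → V} {c : Fin (m + 1) → ℝ} :
    c ∈ coordBall (Fin.cons y b : Fin (m + 1) → V) ↔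
      ‖c 0 • y + ∑ i, Fin.tail c i • b i‖ < 1 := by
  simp [coordBall, Fin.sum_univ_succ, Fin.tail]

theorem smul_mem_coordBall {b : Fin k → V} {s : ℝ} (hs : 0 < s) {c : Fin k → ℝ} :
    s • c ∈ coordBall b ↔ s * ‖∑ i, c i • b i‖ < 1 := by
  simp [coordBall, mul_smul, ← Finset.smul_sum, norm_smul, abs_of_pos hs]

theorem coordCylinder_subset_coordBall_cons {y : V} (hy : y ≠ 0) (b : Fin m → V) :
    coordCylinder b (2 * ‖y‖)⁻¹ 2 ⊆ coordBall (Fin.cons y b : Fin (m + 1) → V) := by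
  rintro c ⟨h0, h1⟩
  rw [smul_mem_coordBall two_pos] at h1
  rw [mem_coordBall_cons]
  have hy' : 0 < ‖y‖ := norm_pos_iff.2 hy
  have h2 : |c 0| * (2 * ‖y‖) < 1 := by
    rwa [← lt_div_iff₀ (by positivity), one_div]
  have h3 := norm_add_le (c 0 • y) (∑ i, Fin.tail c i • b i)
  rw [norm_smul, Real.norm_eq_abs] at h3
  linarith

theorem coordBall_cons_subset_coordCylinder {y : V} (hy : y ≠ 0) {b : Fin m → V}
    (hb : (Submodule.span ℝ (Set.range b) : Set V) ⊆ normalSet y) :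
    coordBall (Fin.cons y b : Fin (m + 1) → V) ⊆ coordCylinder b ‖y‖⁻¹ 2⁻¹ := by
  intro c hc
  rw [mem_coordBall_cons] at hc
  have hw : ∑ i, Fin.tail c i • b i ∈ Submodule.span ℝ (Set.range b) :=
    Submodule.sum_mem _ fun i _ => Submodule.smul_mem _ _ (Submodule.subset_span ⟨i, rfl⟩)
  have h0 := (abs_mul_norm_le_norm_smul_add hb hw (c 0)).trans_lt hc
  have hy' : 0 < ‖y‖ := norm_pos_iff.2 hy
  refine ⟨by rwa [← one_div, lt_div_iff₀ hy'], ?_⟩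
  rw [smul_mem_coordBall (by norm_num)]
  have h3 := norm_sub_le (c 0 • y + ∑ i, Fin.tail c i • b i) (c 0 • y)
  rw [add_sub_cancel_left, norm_smul, Real.norm_eq_abs] at h3
  linarith

theorem norm_inv_mul_volume_coordBall_le {y : V} (hy : y ≠ 0) (b : Fin m → V) :
    ENNReal.ofReal ‖y‖⁻¹ * volume (coordBall b) ≤
      2 ^ m * volume (coordBall (Fin.cons y b : Fin (m + 1) → V)) := by
  have h := measure_mono (μ := volume) (coordCylinder_subset_coordBall_cons hy b)
  rw [volume_coordCylinder b _ two_pos] at h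
  have h1 : 2 * (2 * ‖y‖)⁻¹ = ‖y‖⁻¹ := by ring
  have h2 : (2 : ENNReal) ^ m * ENNReal.ofReal (2 ^ m)⁻¹ = 1 := by
    rw [ENNReal.ofReal_inv_of_pos (by positivity), ENNReal.ofReal_pow zero_le_two,
      ENNReal.ofReal_ofNat]
    exact ENNReal.mul_inv_cancel (by simp) (by simp)
  rw [h1] at h
  calc ENNReal.ofReal ‖y‖⁻¹ * volume (coordBall b)
      = 2 ^ m * ENNReal.ofReal (2 ^ m)⁻¹ *
          (ENNReal.ofReal ‖y‖⁻¹ * volume (coordBall b)) := by rw [h2, one_mul]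
    _ = 2 ^ m * (ENNReal.ofReal ‖y‖⁻¹ *
          (ENNReal.ofReal (2 ^ m)⁻¹ * volume (coordBall b))) := by ring
    _ ≤ _ := by gcongr

theorem volume_coordBall_cons_le {y : V} (hy : y ≠ 0) {b : Fin m → V}
    (hb : (Submodule.span ℝ (Set.range b) : Set V) ⊆ normalSet y) :
    volume (coordBall (Fin.cons y b : Fin (m + 1) → V)) ≤
      2 ^ (m + 1) * (ENNReal.ofReal ‖y‖⁻¹ * volume (coordBall b)) := by
  have h := measure_mono (μ := volume) (coordBall_cons_subset_coordCylinder hy hb)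
  rw [volume_coordCylinder b _ (by norm_num), inv_pow, inv_inv,
    ENNReal.ofReal_mul zero_le_two, ENNReal.ofReal_pow zero_le_two, ENNReal.ofReal_ofNat] at h
  exact h.trans_eq (by ring)

end CoordBall

theorem ballRatio_nonneg (m : ℕ) : 0 ≤ ballRatio m :=
  div_nonneg measureReal_nonneg measureReal_nonneg

/-- Two-sided bound on the ratio of the volumes of the section and of the ball. -/
theorem volume_ratio_mem_Icc {V : Type*} [NormedAddCommGroup V] [NormedSpace ℝ V] {m : ℕ} {y : V}
    (hy : y ≠ 0) {b : Fin m → V} (hli : LinearIndependent ℝ b)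
    (hcons : LinearIndependent ℝ (Fin.cons y b : Fin (m + 1) → V))
    (hb : (Submodule.span ℝ (Set.range b) : Set V) ⊆ normalSet y) :
    volume.real (coordBall b) /
      (‖y‖ * volume.real (coordBall (Fin.cons y b : Fin (m + 1) → V))) ∈
      Set.Icc ((2 : ℝ) ^ (m + 1))⁻¹ (2 ^ (m + 1)) := by
  have hB := (volume_coordBall_lt_top hli).ne
  have hC := (volume_coordBall_lt_top hcons).ne
  have hCpos : 0 < volume.real (coordBall (Fin.cons y b : Fin (m + 1) → V)) :=
    ENNReal.toReal_pos (volume_coordBall_pos _).ne' hC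
  have hy' : 0 < ‖y‖ := norm_pos_iff.2 hy
  have h1 := ENNReal.toReal_mono (ENNReal.mul_ne_top (by simp) hC)
    (norm_inv_mul_volume_coordBall_le hy b)
  have h2 := ENNReal.toReal_mono
    (ENNReal.mul_ne_top (by simp) (ENNReal.mul_ne_top (by simp) hB))
    (volume_coordBall_cons_le hy hb)
  simp only [ENNReal.toReal_mul, ENNReal.toReal_pow, ENNReal.toReal_ofNat,
    ENNReal.toReal_ofReal (inv_nonneg.2 hy'.le), ← measureReal_def] at h1 h2
  rw [inv_mul_le_iff₀ hy'] at h1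
  rw [mul_left_comm, ← div_eq_inv_mul, le_div_iff₀ hy'] at h2
  constructor
  · rw [le_div_iff₀ (by positivity), inv_mul_le_iff₀ (by positivity)]
    linarith
  · rw [div_le_iff₀ (by positivity)]
    have : 0 ≤ ‖y‖ * (2 ^ m * volume.real (coordBall (Fin.cons y b : Fin (m + 1) → V))) := by
      positivity
    rw [pow_succ]
    linarith

/-- Let `(V, F)` be a real normed space of dimension `n = m + 1` and `y ∈ V` nonzero.
If `F` is differentiable at `y`, then `W_y` is a linear hyperplane. For any norm `F`, if
`b₂, …, bₙ` are linearly independent and `y` is normal to every vector of their span, then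
`y, b₂, …, bₙ` is a basis of `V`, the two volume inequalities hold when `F(y) = 1`, and
`2⁻ⁿ c_n ≤ ζ(y) ≤ 2ⁿ c_n`. -/
theorem stmt18 {V : Type*} [NormedAddCommGroup V] [NormedSpace ℝ V] [FiniteDimensional ℝ V]
    (m : ℕ) (hdim : Module.finrank ℝ V = m + 1) (y : V) (hy : y ≠ 0) :
    (DifferentiableAt ℝ (fun v : V => ‖v‖) y →
      ∃ W : Submodule ℝ V, (W : Set V) = normalSet y ∧ Module.finrank ℝ W = m) ∧
    ∀ b : Fin m → V, LinearIndependent ℝ b →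
      (Submodule.span ℝ (Set.range b) : Set V) ⊆ normalSet y →
      LinearIndependent ℝ (Fin.cons y b : Fin (m + 1) → V) ∧
      Submodule.span ℝ (Set.range (Fin.cons y b : Fin (m + 1) → V)) = ⊤ ∧
      (‖y‖ = 1 →
        volume (coordBall b) ≤
            2 ^ (m + 1) * volume (coordBall (Fin.cons y b : Fin (m + 1) → V)) ∧
          volume (coordBall (Fin.cons y b : Fin (m + 1) → V)) ≤
            2 ^ (m + 1) * volume (coordBall b)) ∧
      ((2 : ℝ) ^ (m + 1))⁻¹ * ballRatio m ≤ zeta y b ∧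
      zeta y b ≤ (2 : ℝ) ^ (m + 1) * ballRatio m := by
  refine ⟨fun h => ⟨_, (normalSet_eq_ker_fderiv_norm h).symm, ?_⟩, fun b hli hb => ?_⟩
  · have := finrank_ker_fderiv_norm_add_one hy h
    lia
  have hcons : LinearIndependent ℝ (Fin.cons y b : Fin (m + 1) → V) :=
    linearIndependent_finCons.2 ⟨hli, fun h => not_isNormalTo_self hy (hb h)⟩
  have hratio := volume_ratio_mem_Icc hy hli hcons hb
  refine ⟨hcons, hcons.span_eq_top_of_card_eq_finrank' (by simp [hdim]), fun h1 => ⟨?_, ?_⟩,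
    ?_, ?_⟩
  · have h := norm_inv_mul_volume_coordBall_le hy b
    rw [h1, inv_one, ENNReal.ofReal_one, one_mul] at h
    refine h.trans ?_
    gcongr
    · norm_num
    · lia
  · simpa [h1] using volume_coordBall_cons_le hy hb
  · rw [zeta, mul_comm]
    exact mul_le_mul_of_nonneg_left hratio.1 (ballRatio_nonneg m)
  · rw [zeta, mul_comm ((2 : ℝ) ^ (m + 1))]
    exact mul_le_mul_of_nonneg_left hratio.2 (ballRatio_nonneg m)
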